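/- arXiv:1112.2511 — 2 statements merged into one kernel-verified Lean document; each statement's English description precedes it below -/
import Mathlib

section
/- Let γ > 0 (the Immirzi parameter), κ > 0 the deformation exponent with q = e^{-κ}, and let l_p > 0 (Planck length) and l_c > 0 (cosmological length) be related by κ = l_p²/l_c². Let K be a positive half-integer (K = k/2 with k a positive natural number) satisfying the EPRL label constraint K ≤ 4π/(γκ). Then the area eigenvalue A = 8π l_p² γ √(K(K+1)) satisfies the bound A ≤ 32π² l_c² + 4π γ l_p². -/
open Real

/-- In the q-deformed Lorentzian EPRL model with `q = exp (-κ)`, `κ = l_p² / l_c²`,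
the area eigenvalue `A = 8π l_p² γ √(K(K+1))` of a triangle coloured by an admissible
EPRL label `K = k/2`, `0 < K ≤ 4π/(γκ)`, is bounded by `32π² l_c² + 4πγ l_p²`. -/
theorem eprl_area_bound (γ κ lp lc : ℝ) (hγ : 0 < γ) (hκ : 0 < κ)
    (hlp : 0 < lp) (hlc : 0 < lc) (hκdef : κ = lp ^ 2 / lc ^ 2)
    (k : ℕ) (hk : 0 < k) (K : ℝ) (hK : K = (k : ℝ) / 2)
    (hlabel : K ≤ 4 * π / (γ * κ)) :
    8 * π * lp ^ 2 * γ * Real.sqrt (K * (K + 1)) ≤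
      32 * π ^ 2 * lc ^ 2 + 4 * π * γ * lp ^ 2 := by
  have hK0 : 0 < K := by rw [hK]; positivity
  have hsqrt : Real.sqrt (K * (K + 1)) ≤ K + 1 / 2 :=
    Real.sqrt_le_iff.mpr ⟨by positivity, by nlinarith⟩
  have hκlc : κ * lc ^ 2 = lp ^ 2 := by rw [hκdef]; field_simp
  have hKγκ : K * (γ * κ) ≤ 4 * π := (le_div_iff₀ (by positivity)).mp hlabel
  calc 8 * π * lp ^ 2 * γ * Real.sqrt (K * (K + 1))
      ≤ 8 * π * lp ^ 2 * γ * (K + 1 / 2) := by gcongr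
    _ = 8 * π * lc ^ 2 * (K * (γ * κ)) + 4 * π * γ * lp ^ 2 := by rw [← hκlc]; ring
    _ ≤ 8 * π * lc ^ 2 * (4 * π) + 4 * π * γ * lp ^ 2 := by gcongr
    _ = 32 * π ^ 2 * lc ^ 2 + 4 * π * γ * lp ^ 2 := by ring
end

section
/- Let γ > 0, κ > 0, l_p > 0, l_c > 0 with κ = l_p²/l_c². Let K be a positive half-integer (K = k/2 with k a positive natural number) satisfying the strengthened constraint K + 1/2 ≤ 4π/(γκ). Then the area eigenvalue satisfies the exact bound 8π l_p² γ √(K(K+1)) ≤ 32π² l_c². -/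
open Real

/-- In the q-deformed Lorentzian EPRL model with `κ = l_p² / l_c²`, if the half-integer
label `K = k/2` satisfies the strengthened constraint `K + 1/2 ≤ 4π/(γκ)`, then the
area eigenvalue `8π l_p² γ √(K(K+1))` is bounded exactly by `32π² l_c²`. -/
theorem eprl_area_bound_exact (γ κ lp lc : ℝ) (hγ : 0 < γ) (hκ : 0 < κ)
    (hlp : 0 < lp) (hlc : 0 < lc) (hκdef : κ = lp ^ 2 / lc ^ 2)
    (k : ℕ) (hk : 0 < k) (K : ℝ) (hK : K = (k : ℝ) / 2)
    (hlabel : K + 1 / 2 ≤ 4 * π / (γ * κ)) :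
    8 * π * lp ^ 2 * γ * Real.sqrt (K * (K + 1)) ≤ 32 * π ^ 2 * lc ^ 2 := by
  have hK0 : 0 ≤ K := by rw [hK]; positivity
  have hsqrt : √(K * (K + 1)) ≤ 4 * π / (γ * κ) :=
    (Real.sqrt_le_iff.mpr ⟨by positivity, by nlinarith⟩ : _ ≤ K + 1 / 2).trans hlabel
  calc 8 * π * lp ^ 2 * γ * √(K * (K + 1))
      ≤ 8 * π * lp ^ 2 * γ * (4 * π / (γ * κ)) := by gcongr
    _ = 32 * π ^ 2 * lc ^ 2 := by
      rw [hκdef]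
      field_simp
      norm_num
end
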